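/- Let n ≥ 3. For the sunflower graph SF_n, the maximum first chromatic Zagreb index satisfies M₁^{φ+}(SF_n) = (23n + 18)/2 if n is even, and M₁^{φ+}(SF_n) = (45n + 21)/2 if n is odd. -/

import Mathlib

open Finset

/-- Vertex type: `none` is the center `u`; `some (Sum.inl i)` is `uᵢ`;
`some (Sum.inr i)` is `vᵢ`. -/
abbrev GV (n : ℕ) : Type := Option (Fin n ⊕ Fin n)

/-- `j = i + 1 (mod n)`: `j` is the cyclic successor of `i` in `Fin n`. -/
def NextIdx {n : ℕ} (i j : Fin n) : Prop := (j : ℕ) = ((i : ℕ) + 1) % n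

/-- The sunflower graph `SF_n`: edges `uᵢu_{i+1}` (indices mod `n`), `u uᵢ`,
`vᵢuᵢ` and `vᵢu_{i+1}` for all `i`. -/
def sunflowerGraph (n : ℕ) : SimpleGraph (GV n) :=
  SimpleGraph.fromRel (fun a b =>
    (∃ i j : Fin n, NextIdx i j ∧ a = some (Sum.inl i) ∧ b = some (Sum.inl j)) ∨
    (∃ i : Fin n, a = none ∧ b = some (Sum.inl i)) ∨
    (∃ i : Fin n, a = some (Sum.inr i) ∧ b = some (Sum.inl i)) ∨
    (∃ i j : Fin n, NextIdx i j ∧ a = some (Sum.inr i) ∧ b = some (Sum.inl j)))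

/-- `ζ` is a proper vertex coloring of `G` using the colors `{1, …, k}`:
every vertex gets a color in `{1, …, k}` and adjacent vertices get
different colors. -/
def IsProperColoring {V : Type} (G : SimpleGraph V) (k : ℕ) (ζ : V → ℕ) : Prop :=
  (∀ v, 1 ≤ ζ v ∧ ζ v ≤ k) ∧ ∀ ⦃a b⦄, G.Adj a b → ζ a ≠ ζ b

/-- The chromatic number of `G`, as a natural number. -/
noncomputable def chi {V : Type} (G : SimpleGraph V) : ℕ := G.chromaticNumber.toNat

/-- The first chromatic Zagreb index: `∑_{v ∈ V(G)} ζ(v)²`. -/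
def M1 {V : Type} [Fintype V] (ζ : V → ℕ) : ℚ := ∑ v, (ζ v : ℚ) ^ 2

/-- The edges of the sunflower graph that a proper coloring has to respect, in terms of the cyclic
successor `i + 1` of `Fin n`. -/
theorem isProperColoring_sunflowerGraph_iff {n : ℕ} [NeZero n] (hn : 3 ≤ n) (k : ℕ)
    (ζ : GV n → ℕ) :
    IsProperColoring (sunflowerGraph n) k ζ ↔ (∀ v, 1 ≤ ζ v ∧ ζ v ≤ k) ∧ ∀ i : Fin n,
      ζ (some (Sum.inl i)) ≠ ζ (some (Sum.inl (i + 1))) ∧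
      ζ none ≠ ζ (some (Sum.inl i)) ∧
      ζ (some (Sum.inr i)) ≠ ζ (some (Sum.inl i)) ∧
      ζ (some (Sum.inr i)) ≠ ζ (some (Sum.inl (i + 1))) := by
  have val_succ (i : Fin n) : ((i + 1 : Fin n) : ℕ) = ((i : ℕ) + 1) % n := by
    rw [Fin.val_add, Fin.val_one', Nat.add_mod_mod]
  have next_iff (i j : Fin n) : NextIdx i j ↔ j = i + 1 := by
    rw [NextIdx, Fin.ext_iff, val_succ]
  have succ_ne (i : Fin n) : i ≠ i + 1 := by
    intro h
    have h' := val_succ i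
    rw [← h] at h'
    have hi := i.isLt
    rcases Nat.lt_or_ge ((i : ℕ) + 1) n with hlt | hge
    · rw [Nat.mod_eq_of_lt hlt] at h'
      omega
    · have : (i : ℕ) + 1 = n := by omega
      rw [this, Nat.mod_self] at h'
      omega
  simp only [IsProperColoring, sunflowerGraph, SimpleGraph.fromRel_adj, next_iff]
  refine and_congr_right fun _ => ⟨fun h i => ⟨h ?_, h ?_, h ?_, h ?_⟩, fun h => ?_⟩
  · exact ⟨by simpa using succ_ne i, Or.inl (Or.inl ⟨i, _, rfl, rfl, rfl⟩)⟩
  · exact ⟨by simp, Or.inl (Or.inr (Or.inl ⟨i, rfl, rfl⟩))⟩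
  · exact ⟨by simp, Or.inl (Or.inr (Or.inr (Or.inl ⟨i, rfl, rfl⟩)))⟩
  · exact ⟨by simp, Or.inl (Or.inr (Or.inr (Or.inr ⟨i, _, rfl, rfl, rfl⟩)))⟩
  · rintro a b ⟨-, hab | hab⟩ <;>
      obtain ⟨i, _, rfl, rfl, rfl⟩ | ⟨i, rfl, rfl⟩ | ⟨i, rfl, rfl⟩ | ⟨i, _, rfl, rfl, rfl⟩ := hab
    exacts [(h i).1, (h i).2.1, (h i).2.2.1, (h i).2.2.2,
      (h i).1.symm, (h i).2.1.symm, (h i).2.2.1.symm, (h i).2.2.2.symm]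

theorem colorable_iff_exists_isProperColoring {V : Type} (G : SimpleGraph V) (k : ℕ) :
    G.Colorable k ↔ ∃ ζ, IsProperColoring G k ζ := by
  rw [SimpleGraph.colorable_iff_exists_bdd_nat_coloring]
  constructor
  · rintro ⟨C, hC⟩
    exact ⟨fun v => C v + 1, fun v => ⟨Nat.succ_pos _, hC v⟩, fun a b hab h =>
      C.valid hab (Nat.succ_injective h)⟩
  · rintro ⟨ζ, hb, hp⟩
    refine ⟨SimpleGraph.Coloring.mk (fun v => ζ v - 1) fun {a b} hab h => hp hab ?_, fun v => ?_⟩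
    · have := (hb a).1
      have := (hb b).1
      omega
    · change ζ v - 1 < k
      have := hb v
      omega

theorem chi_eq_succ {V : Type} {G : SimpleGraph V} {k : ℕ} {ζ : V → ℕ}
    (hζ : IsProperColoring G (k + 1) ζ) (hk : ∀ ξ, ¬ IsProperColoring G k ξ) :
    chi G = k + 1 := by
  have hle : G.Colorable (k + 1) := (colorable_iff_exists_isProperColoring G _).2 ⟨ζ, hζ⟩
  have hnot : ¬ G.Colorable k := fun h =>
    let ⟨ξ, hξ⟩ := (colorable_iff_exists_isProperColoring G k).1 h
    hk ξ hξ
  have h : G.chromaticNumber = ((k + 1 : ℕ) : ℕ∞) := by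
    refine le_antisymm hle.chromaticNumber_le ?_
    rw [← not_lt]
    intro hlt
    rw [Nat.cast_add, Nat.cast_one, ENat.lt_add_one_iff (ENat.natCast_ne_top k)] at hlt
    exact hnot (SimpleGraph.chromaticNumber_le_iff_colorable.1 hlt)
  rw [chi, h, ENat.toNat_natCast]

theorem M1_eq {n : ℕ} (ζ : GV n → ℕ) :
    M1 ζ = (ζ none : ℚ) ^ 2 + (∑ i : Fin n, (ζ (some (Sum.inl i)) : ℚ) ^ 2 +
      ∑ i : Fin n, (ζ (some (Sum.inr i)) : ℚ) ^ 2) := by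
  rw [M1, Fintype.sum_option, Fintype.sum_sum_type]

theorem sum_add_one_eq {n : ℕ} [NeZero n] {M : Type*} [AddCommMonoid M] (f : Fin n → M) :
    ∑ i, f (i + 1) = ∑ i, f i :=
  Equiv.sum_comp (Equiv.addRight 1) f

/-- A bound on the weight of each triangle `uᵢ u_{i+1} vᵢ` bounds the Zagreb index. -/
theorem two_mul_M1_le {n : ℕ} [NeZero n] (ζ : GV n → ℕ) (B : ℕ)
    (h : ∀ i : Fin n, 2 * ζ (some (Sum.inr i)) ^ 2 + ζ (some (Sum.inl i)) ^ 2 +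
      ζ (some (Sum.inl (i + 1))) ^ 2 ≤ B) :
    2 * M1 ζ ≤ 2 * (ζ none : ℚ) ^ 2 + n * B := by
  have hs : ∑ i : Fin n, (2 * (ζ (some (Sum.inr i)) : ℚ) ^ 2 + (ζ (some (Sum.inl i)) : ℚ) ^ 2 +
      (ζ (some (Sum.inl (i + 1))) : ℚ) ^ 2) ≤ ∑ _i : Fin n, (B : ℚ) :=
    Finset.sum_le_sum fun i _ => by exact_mod_cast h i
  rw [Finset.sum_add_distrib, Finset.sum_add_distrib, ← Finset.mul_sum,
    sum_add_one_eq fun i : Fin n => (ζ (some (Sum.inl i)) : ℚ) ^ 2, Finset.sum_const,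
    Finset.card_univ, Fintype.card_fin, nsmul_eq_mul] at hs
  rw [M1_eq]
  linarith

/-- A color class of a proper coloring of a cycle contains at most half of the vertices. -/
theorem two_mul_sum_indicator_le {n : ℕ} [NeZero n] (f : Fin n → ℕ)
    (hf : ∀ i, f i ≠ f (i + 1)) (c : ℕ) : 2 * ∑ i, (if f i = c then 1 else 0) ≤ n := by
  calc 2 * ∑ i, (if f i = c then 1 else 0)
      = ∑ i, ((if f i = c then 1 else 0) + if f (i + 1) = c then 1 else 0) := by
        rw [Finset.sum_add_distrib, sum_add_one_eq fun i => if f i = c then 1 else 0, two_mul]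
    _ ≤ ∑ _i : Fin n, 1 := Finset.sum_le_sum fun i _ => by
        have := hf i
        split_ifs <;> omega
    _ = n := by simp

theorem not_isProperColoring_two {n : ℕ} [NeZero n] (hn : 3 ≤ n) (ζ : GV n → ℕ) :
    ¬ IsProperColoring (sunflowerGraph n) 2 ζ := by
  rw [isProperColoring_sunflowerGraph_iff hn]
  rintro ⟨hb, hp⟩
  have h0 := hp 0
  have := hb (some (Sum.inl 0))
  have := hb (some (Sum.inl (0 + 1)))
  have := hb (some (Sum.inr 0))
  omega

theorem not_isProperColoring_three {n : ℕ} [NeZero n] (hn : 3 ≤ n) (hodd : Odd n)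
    (ζ : GV n → ℕ) : ¬ IsProperColoring (sunflowerGraph n) 3 ζ := by
  rw [isProperColoring_sunflowerGraph_iff hn]
  rintro ⟨hb, hp⟩
  obtain ⟨a, b, hab⟩ : ∃ a b, ∀ x, 1 ≤ x ∧ x ≤ 3 → ζ none ≠ x → x = a ∨ x = b := by
    have h0 := hb none
    obtain h | h | h : ζ none = 1 ∨ ζ none = 2 ∨ ζ none = 3 := by omega
    · exact ⟨2, 3, by omega⟩
    · exact ⟨1, 3, by omega⟩
    · exact ⟨1, 2, by omega⟩
  have ha := two_mul_sum_indicator_le (fun i => ζ (some (Sum.inl i))) (fun i => (hp i).1) a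
  have hb' := two_mul_sum_indicator_le (fun i => ζ (some (Sum.inl i))) (fun i => (hp i).1) b
  have hcover : ∑ _i : Fin n, 1 ≤ ∑ i : Fin n, ((if ζ (some (Sum.inl i)) = a then 1 else 0) +
      if ζ (some (Sum.inl i)) = b then 1 else 0) := Finset.sum_le_sum fun i _ => by
    rcases hab _ (hb (some (Sum.inl i))) (hp i).2.1 with h | h <;> simp [h]
  rw [Finset.sum_add_distrib, Finset.sum_const, Finset.card_univ, Fintype.card_fin] at hcover
  obtain ⟨m, rfl⟩ := hodd
  simp only [smul_eq_mul, mul_one] at hcover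
  omega

theorem M1_le_of_isProperColoring_three {n : ℕ} [NeZero n] (hn : 3 ≤ n) {ζ : GV n → ℕ}
    (hζ : IsProperColoring (sunflowerGraph n) 3 ζ) : M1 ζ ≤ (23 * (n : ℚ) + 18) / 2 := by
  obtain ⟨hb, hp⟩ := (isProperColoring_sunflowerGraph_iff hn 3 ζ).1 hζ
  have h := two_mul_M1_le ζ 23 fun i => by
    obtain ⟨h1, -, h2, h3⟩ := hp i
    obtain ⟨hx, hx'⟩ := hb (some (Sum.inl i))
    obtain ⟨hy, hy'⟩ := hb (some (Sum.inl (i + 1)))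
    obtain ⟨hz, hz'⟩ := hb (some (Sum.inr i))
    generalize ζ (some (Sum.inl i)) = x at *
    generalize ζ (some (Sum.inl (i + 1))) = y at *
    generalize ζ (some (Sum.inr i)) = z at *
    interval_cases x <;> interval_cases y <;> interval_cases z <;> omega
  have h0 : (ζ none : ℚ) ^ 2 ≤ 3 ^ 2 := by exact_mod_cast Nat.pow_le_pow_left (hb none).2 2
  push_cast at h
  linarith

theorem M1_le_of_isProperColoring_four {n : ℕ} [NeZero n] (hn : 3 ≤ n) (hodd : Odd n)
    {ζ : GV n → ℕ} (hζ : IsProperColoring (sunflowerGraph n) 4 ζ) :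
    M1 ζ ≤ (45 * (n : ℚ) + 21) / 2 := by
  obtain ⟨hb, hp⟩ := (isProperColoring_sunflowerGraph_iff hn 4 ζ).1 hζ
  by_cases hc : ζ none ≤ 3
  · have h := two_mul_M1_le ζ 45 fun i => by
      obtain ⟨h1, -, h2, h3⟩ := hp i
      obtain ⟨hx, hx'⟩ := hb (some (Sum.inl i))
      obtain ⟨hy, hy'⟩ := hb (some (Sum.inl (i + 1)))
      obtain ⟨hz, hz'⟩ := hb (some (Sum.inr i))
      generalize ζ (some (Sum.inl i)) = x at *
      generalize ζ (some (Sum.inl (i + 1))) = y at *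
      generalize ζ (some (Sum.inr i)) = z at *
      interval_cases x <;> interval_cases y <;> interval_cases z <;> omega
    have h0 : (ζ none : ℚ) ^ 2 ≤ 3 ^ 2 := by exact_mod_cast Nat.pow_le_pow_left hc 2
    push_cast at h
    linarith
  · have h4 : ζ none = 4 := by
      have := hb none
      omega
    have h2 := two_mul_sum_indicator_le (fun i => ζ (some (Sum.inl i))) (fun i => (hp i).1) 2
    have h3 := two_mul_sum_indicator_le (fun i => ζ (some (Sum.inl i))) (fun i => (hp i).1) 3
    have hu : ∑ i : Fin n, ζ (some (Sum.inl i)) ^ 2 ≤ ∑ i : Fin n,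
        (1 + 3 * (if ζ (some (Sum.inl i)) = 2 then 1 else 0) +
          8 * if ζ (some (Sum.inl i)) = 3 then 1 else 0) := Finset.sum_le_sum fun i _ => by
      obtain ⟨hx, hx'⟩ := hb (some (Sum.inl i))
      have := (hp i).2.1
      generalize ζ (some (Sum.inl i)) = x at *
      interval_cases x <;> simp_all
    have hv : ∑ i : Fin n, ζ (some (Sum.inr i)) ^ 2 ≤ ∑ _i : Fin n, 16 :=
      Finset.sum_le_sum fun i _ => Nat.pow_le_pow_left (hb (some (Sum.inr i))).2 2
    rw [Finset.sum_add_distrib, Finset.sum_add_distrib, ← Finset.mul_sum, ← Finset.mul_sum] at hu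
    simp only [Finset.sum_const, Finset.card_univ, Fintype.card_fin, smul_eq_mul, mul_one]
      at hu hv
    have key : 2 * (∑ i : Fin n, ζ (some (Sum.inl i)) ^ 2 +
        ∑ i : Fin n, ζ (some (Sum.inr i)) ^ 2) + 11 ≤ 45 * n := by
      obtain ⟨m, rfl⟩ := hodd
      omega
    have key' : 2 * (∑ i : Fin n, (ζ (some (Sum.inl i)) : ℚ) ^ 2 +
        ∑ i : Fin n, (ζ (some (Sum.inr i)) : ℚ) ^ 2) + 11 ≤ 45 * n := by exact_mod_cast key
    rw [M1_eq, h4]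
    push_cast
    linarith

/-- The coloring giving color `c` to the center and to every `vᵢ`, and color `f i` to `uᵢ`. -/
def rimColoring (n c : ℕ) (f : ℕ → ℕ) : GV n → ℕ
  | none => c
  | some (Sum.inl i) => f i
  | some (Sum.inr _) => c

theorem isProperColoring_rimColoring {n : ℕ} [NeZero n] (hn : 3 ≤ n) {c : ℕ} {f : ℕ → ℕ}
    (hf : ∀ i, 1 ≤ f i ∧ f i < c) (hstep : ∀ i, i + 1 < n → f i ≠ f (i + 1))
    (hlast : f (n - 1) ≠ f 0) :
    IsProperColoring (sunflowerGraph n) c (rimColoring n c f) := by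
  rw [isProperColoring_sunflowerGraph_iff hn]
  have hc := hf 0
  refine ⟨?_, fun i => ⟨?_, (hf _).2.ne', (hf _).2.ne', (hf _).2.ne'⟩⟩
  · rintro (_ | i | i)
    · exact ⟨by change 1 ≤ c; omega, le_rfl⟩
    · exact ⟨(hf i).1, (hf i).2.le⟩
    · exact ⟨by change 1 ≤ c; omega, le_rfl⟩
  · change f (i : ℕ) ≠ f ((i + 1 : Fin n) : ℕ)
    rw [Fin.val_add, Fin.val_one', Nat.add_mod_mod]
    have hi := i.isLt
    rcases Nat.lt_or_ge ((i : ℕ) + 1) n with hlt | hge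
    · rw [Nat.mod_eq_of_lt hlt]
      exact hstep i hlt
    · have h : (i : ℕ) + 1 = n := by omega
      rw [h, Nat.mod_self, show (i : ℕ) = n - 1 by omega]
      exact hlast

theorem M1_rimColoring (n c : ℕ) (f : ℕ → ℕ) :
    M1 (rimColoring n c f) = (c : ℚ) ^ 2 * (n + 1) + ∑ i ∈ Finset.range n, (f i : ℚ) ^ 2 := by
  rw [M1_eq, Finset.sum_range]
  simp only [rimColoring, Finset.sum_const, Finset.card_univ, Fintype.card_fin, nsmul_eq_mul]
  ring

theorem sum_range_two_mul_alternating (a b : ℚ) (m : ℕ) :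
    ∑ i ∈ Finset.range (2 * m), (if i % 2 = 0 then a else b) = m * (a + b) := by
  induction m with
  | zero => simp
  | succ m ih =>
    rw [Nat.mul_succ, Finset.sum_range_succ, Finset.sum_range_succ, ih,
      if_pos (by omega), if_neg (by omega)]
    push_cast
    ring

theorem exists_isProperColoring_three {n : ℕ} [NeZero n] (hn : 3 ≤ n) (heven : Even n) :
    ∃ ζ, IsProperColoring (sunflowerGraph n) 3 ζ ∧ (23 * (n : ℚ) + 18) / 2 = M1 ζ := by
  refine ⟨rimColoring n 3 fun i => if i % 2 = 0 then 1 else 2,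
    isProperColoring_rimColoring hn ?_ ?_ ?_, ?_⟩
  · intro i
    split_ifs <;> omega
  · intro i _
    split_ifs <;> omega
  · obtain ⟨m, rfl⟩ := heven
    split_ifs <;> omega
  · obtain ⟨m, rfl⟩ := heven
    have h := sum_range_two_mul_alternating (1 ^ 2) (2 ^ 2) m
    rw [M1_rimColoring, ← two_mul]
    simp only [apply_ite (Nat.cast : ℕ → ℚ), ite_pow, Nat.cast_one, Nat.cast_ofNat]
    rw [h]
    push_cast
    ring

theorem exists_isProperColoring_four {n : ℕ} [NeZero n] (hn : 3 ≤ n) (hodd : Odd n) :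
    ∃ ζ, IsProperColoring (sunflowerGraph n) 4 ζ ∧ (45 * (n : ℚ) + 21) / 2 = M1 ζ := by
  refine ⟨rimColoring n 4 fun i => if i = n - 1 then 1 else if i % 2 = 0 then 2 else 3,
    isProperColoring_rimColoring hn ?_ ?_ ?_, ?_⟩
  · intro i
    split_ifs <;> omega
  · intro i _
    split_ifs <;> omega
  · split_ifs <;> omega
  · obtain ⟨m, rfl⟩ := hodd
    have h := sum_range_two_mul_alternating (2 ^ 2) (3 ^ 2) m
    have hrim : ∑ i ∈ Finset.range (2 * m), (((if i = 2 * m + 1 - 1 then 1 else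
        if i % 2 = 0 then 2 else 3 : ℕ) : ℚ)) ^ 2 = m * (2 ^ 2 + 3 ^ 2) := by
      rw [← h]
      refine Finset.sum_congr rfl fun i hi => ?_
      rw [Finset.mem_range] at hi
      rw [if_neg (by omega)]
      split_ifs <;> norm_num
    rw [M1_rimColoring, Finset.sum_range_succ, hrim, if_pos (by omega)]
    push_cast
    ring

theorem sunflower_M1_max (n : ℕ) (hn : 3 ≤ n) :
    (Even n → IsGreatest {x : ℚ | ∃ ζ : GV n → ℕ,
        IsProperColoring (sunflowerGraph n) (chi (sunflowerGraph n)) ζ ∧ x = M1 ζ}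
      ((23 * (n : ℚ) + 18) / 2)) ∧
    (Odd n → IsGreatest {x : ℚ | ∃ ζ : GV n → ℕ,
        IsProperColoring (sunflowerGraph n) (chi (sunflowerGraph n)) ζ ∧ x = M1 ζ}
      ((45 * (n : ℚ) + 21) / 2)) := by
  have : NeZero n := ⟨by omega⟩
  constructor
  · intro heven
    obtain ⟨ζ, hζ, hM⟩ := exists_isProperColoring_three hn heven
    rw [chi_eq_succ hζ (not_isProperColoring_two hn)]
    refine ⟨⟨ζ, hζ, hM⟩, ?_⟩
    rintro _ ⟨ξ, hξ, rfl⟩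
    exact M1_le_of_isProperColoring_three hn hξ
  · intro hodd
    obtain ⟨ζ, hζ, hM⟩ := exists_isProperColoring_four hn hodd
    rw [chi_eq_succ hζ (not_isProperColoring_three hn hodd)]
    refine ⟨⟨ζ, hζ, hM⟩, ?_⟩
    rintro _ ⟨ξ, hξ, rfl⟩
    exact M1_le_of_isProperColoring_four hn hodd hξ
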